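/- The update family 𝒰_S is critical, and its difficulty satisfies α(𝒰_S) = s² + s + m, where m is the minimum cardinality of a cover of the set cover instance (S_1,…,S_s). -/

import Mathlib

open scoped Classical

/-- A site of the two-dimensional lattice. -/
abbrev Site : Type := ℤ × ℤ

/-- An update family: a finite nonempty collection of finite nonempty rules,
none containing the origin. We represent the collection as a `Finset (Finset Site)`
together with this well-formedness predicate. -/
def IsUpdateFamily (𝒰 : Finset (Finset Site)) : Prop :=
  𝒰.Nonempty ∧ ∀ U ∈ 𝒰, U.Nonempty ∧ ((0, 0) : Site) ∉ U

/-- One step of the bootstrap percolation dynamics. -/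
def bpStep (𝒰 : Finset (Finset Site)) (A : Set Site) : Set Site :=
  A ∪ {x : Site | ∃ U ∈ 𝒰, ∀ y ∈ U, x + y ∈ A}

/-- The configuration after `t` steps of the dynamics started from `A`. -/
def bpIter (𝒰 : Finset (Finset Site)) (A : Set Site) : ℕ → Set Site
  | 0 => A
  | n + 1 => bpStep 𝒰 (bpIter 𝒰 A n)

/-- The closure `[A]` of a set `A` under the bootstrap dynamics. -/
def bpClosure (𝒰 : Finset (Finset Site)) (A : Set Site) : Set Site :=
  ⋃ n : ℕ, bpIter 𝒰 A n

/-- The unit circle `S¹ ⊆ ℝ²`. -/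
def sphere2 : Set (ℝ × ℝ) := {u : ℝ × ℝ | u.1 ^ 2 + u.2 ^ 2 = 1}

/-- Inner product of a lattice site with a real vector. -/
def inner2 (x : Site) (u : ℝ × ℝ) : ℝ := (x.1 : ℝ) * u.1 + (x.2 : ℝ) * u.2

/-- The open half-plane `H_u` with outer normal `u`. -/
def halfPlane (u : ℝ × ℝ) : Set Site := {x : Site | inner2 x u < 0}

/-- The lattice line `l_u` through the origin perpendicular to `u`. -/
def lineu (u : ℝ × ℝ) : Set Site := {x : Site | inner2 x u = 0}

/-- A direction `u` is unstable if some rule lies in `H_u`. -/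
def Unstable (𝒰 : Finset (Finset Site)) (u : ℝ × ℝ) : Prop :=
  ∃ U ∈ 𝒰, (U : Set Site) ⊆ halfPlane u

/-- A direction of the unit circle is stable if it is not unstable. -/
def Stable (𝒰 : Finset (Finset Site)) (u : ℝ × ℝ) : Prop :=
  u ∈ sphere2 ∧ ¬ Unstable 𝒰 u

/-- The set of stable directions. -/
def stableSet (𝒰 : Finset (Finset Site)) : Set (ℝ × ℝ) := {u | Stable 𝒰 u}

/-- An isolated stable direction: a stable direction not in the (topological)
closure of the set of other stable directions. -/
def IsolatedStable (𝒰 : Finset (Finset Site)) (u : ℝ × ℝ) : Prop :=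
  Stable 𝒰 u ∧ u ∉ closure (stableSet 𝒰 \ {u})

/-- The open semicircle of the unit circle centred at the direction `v`. -/
def openSemicircle (v : ℝ × ℝ) : Set (ℝ × ℝ) :=
  {u ∈ sphere2 | 0 < u.1 * v.1 + u.2 * v.2}

/-- A family is supercritical if some open semicircle consists of unstable directions. -/
def Supercritical (𝒰 : Finset (Finset Site)) : Prop :=
  ∃ v ∈ sphere2, ∀ u ∈ openSemicircle v, Unstable 𝒰 u

/-- A family is critical if it is not supercritical and some open semicircle
contains only finitely many stable directions. -/
def Critical (𝒰 : Finset (Finset Site)) : Prop :=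
  ¬ Supercritical 𝒰 ∧ ∃ v ∈ sphere2, (stableSet 𝒰 ∩ openSemicircle v).Finite

/-- The difficulty `α(u)` of a direction: `0` for unstable directions, `∞` for
non-isolated stable directions, and for isolated stable directions the minimum
cardinality of a finite `Z ⊆ ℤ² ∖ H_u` such that `[H_u ∪ Z] ∖ H_u` is infinite. -/
noncomputable def dirDifficulty (𝒰 : Finset (Finset Site)) (u : ℝ × ℝ) : ℕ∞ :=
  if Unstable 𝒰 u then 0
  else if IsolatedStable 𝒰 u then
    sInf {n : ℕ∞ | ∃ Z : Finset Site, (∀ z ∈ Z, z ∉ halfPlane u) ∧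
      (bpClosure 𝒰 (halfPlane u ∪ (Z : Set Site)) \ halfPlane u).Infinite ∧ n = Z.card}
  else ⊤

/-- The difficulty `α(𝒰)` of an update family. -/
noncomputable def difficulty (𝒰 : Finset (Finset Site)) : ℕ∞ :=
  ⨅ v ∈ sphere2, ⨆ u ∈ openSemicircle v, dirDifficulty 𝒰 u

/-- The diameter `D` of an update family: `2 · max{‖x‖_∞ : x ∈ ⋃ U ∈ 𝒰, U}`. -/
def famDiam (𝒰 : Finset (Finset Site)) : ℕ :=
  2 * 𝒰.sup (fun U => U.sup (fun x => max x.1.natAbs x.2.natAbs))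

/-- The set `W = {(x,0) : 1 ≤ x ≤ s²} ∪ {(l·s,1) : 1 ≤ l ≤ s}`. -/
noncomputable def Wset (s : ℕ) : Finset Site :=
  (Finset.Icc 1 (s ^ 2)).image (fun x => ((x : ℤ), (0 : ℤ))) ∪
    (Finset.Icc 1 s).image (fun l => (((l * s : ℕ) : ℤ), (1 : ℤ)))

/-- The set `T = {(0,−y) : 1 ≤ y ≤ N·s²}`. -/
noncomputable def Tset (N s : ℕ) : Finset Site :=
  (Finset.Icc 1 (N * s ^ 2)).image (fun y => ((0 : ℤ), -(y : ℤ)))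

/-- The rule `U₀ = {(−k,0) : 1 ≤ k ≤ N·s²} ∪ {(0,−k) : 1 ≤ k ≤ N·s²}`. -/
noncomputable def Urule0 (N s : ℕ) : Finset Site :=
  (Finset.Icc 1 (N * s ^ 2)).image (fun k => (-(k : ℤ), (0 : ℤ))) ∪
    (Finset.Icc 1 (N * s ^ 2)).image (fun k => ((0 : ℤ), -(k : ℤ)))

/-- The rule `U₁ = {(k,0) : 1 ≤ k ≤ N·s²} ∪ {(0,−k) : 1 ≤ k ≤ N·s²}`. -/
noncomputable def Urule1 (N s : ℕ) : Finset Site :=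
  (Finset.Icc 1 (N * s ^ 2)).image (fun k => ((k : ℤ), (0 : ℤ))) ∪
    (Finset.Icc 1 (N * s ^ 2)).image (fun k => ((0 : ℤ), -(k : ℤ)))

/-- The rule `U_{i,j}^k = T ∪ ((W ∪ {(i·s,2)}) − (k+(N+j)·s², 0))`. -/
noncomputable def Uijk (N s i j k : ℕ) : Finset Site :=
  Tset N s ∪
    (Wset s ∪ {(((i * s : ℕ) : ℤ), (2 : ℤ))}).image
      (fun w => w - (((k + (N + j) * s ^ 2 : ℕ) : ℤ), (0 : ℤ)))

/-- The update family `𝒰_S = {U₀,U₁} ∪ {U_{i,j}^k : 1 ≤ i ≤ s, j ∈ S_i, 1 ≤ k ≤ s²}`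
associated to a set cover instance `S`. -/
noncomputable def famS (N s : ℕ) (S : ℕ → Finset ℕ) : Finset (Finset Site) :=
  {Urule0 N s, Urule1 N s} ∪
    (((Finset.Icc 1 s ×ˢ Finset.Icc 1 N ×ˢ Finset.Icc 1 (s ^ 2)).filter
        (fun t => t.2.1 ∈ S t.1)).image (fun t => Uijk N s t.1 t.2.1 t.2.2))

/-- `M` is a cover of the set cover instance `S_1, …, S_s` over `{1,…,N}`. -/
def IsCover (N s : ℕ) (S : ℕ → Finset ℕ) (M : Finset ℕ) : Prop :=
  M ⊆ Finset.Icc 1 s ∧ M.biUnion S = Finset.Icc 1 N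

section Dynamics

variable {𝒰 : Finset (Finset Site)}

lemma bpIter_mono (𝒰 : Finset (Finset Site)) (A : Set Site) : Monotone (bpIter 𝒰 A) :=
  monotone_nat_of_le_succ fun _ => Set.subset_union_left

lemma subset_bpClosure (A : Set Site) : A ⊆ bpClosure 𝒰 A :=
  Set.subset_iUnion (bpIter 𝒰 A) 0

lemma bpClosure_subset {A B : Set Site} (hAB : A ⊆ B)
    (hB : ∀ x, ∀ U ∈ 𝒰, (∀ y ∈ U, x + y ∈ B) → x ∈ B) : bpClosure 𝒰 A ⊆ B := by
  refine Set.iUnion_subset fun n => ?_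
  induction n with
  | zero => exact hAB
  | succ n ih =>
    rintro x (hx | ⟨U, hU, hx⟩)
    · exact ih hx
    · exact hB x U hU fun y hy => ih (hx y hy)

lemma mem_bpClosure_of_rule {A : Set Site} {U : Finset Site} (hU : U ∈ 𝒰) {x : Site}
    (hx : ∀ y ∈ U, x + y ∈ bpClosure 𝒰 A) : x ∈ bpClosure 𝒰 A := by
  have hx' : ∀ y ∈ U, ∃ n, x + y ∈ bpIter 𝒰 A n := fun y hy => Set.mem_iUnion.1 (hx y hy)
  choose! f hf using hx'
  refine Set.mem_iUnion.2 ⟨U.sup f + 1, Or.inr ⟨U, hU, fun y hy => ?_⟩⟩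
  exact bpIter_mono 𝒰 A (Finset.le_sup hy) (hf y hy)

end Dynamics

section Rules

variable {N s : ℕ} {S : ℕ → Finset ℕ}

lemma bind_pure_natCast (F : Finset ℕ) :
    (do let a ← F; pure (a : ℤ) : Finset ℤ) = F.image Nat.cast := by
  ext x
  simp [Finset.bind_def, eq_comm]

lemma forall_mem_Wset {P : Site → Prop} :
    (∀ w ∈ Wset s, P w) ↔
      (∀ x : ℕ, 1 ≤ x → x ≤ s ^ 2 → P ((x : ℤ), 0)) ∧
        ∀ l : ℕ, 1 ≤ l → l ≤ s → P ((l : ℤ) * s, 1) := by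
  simp only [Wset, bind_pure_natCast, Finset.forall_mem_union, Finset.forall_mem_image, Finset.mem_Icc, and_imp,
    Nat.cast_mul]

lemma forall_mem_Urule0 {P : Site → Prop} :
    (∀ y ∈ Urule0 N s, P y) ↔
      (∀ k : ℕ, 1 ≤ k → k ≤ N * s ^ 2 → P (-(k : ℤ), 0)) ∧
        ∀ k : ℕ, 1 ≤ k → k ≤ N * s ^ 2 → P (0, -(k : ℤ)) := by
  simp only [Urule0, bind_pure_natCast, Finset.forall_mem_union, Finset.forall_mem_image, Finset.mem_Icc, and_imp]

lemma forall_mem_Urule1 {P : Site → Prop} :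
    (∀ y ∈ Urule1 N s, P y) ↔
      (∀ k : ℕ, 1 ≤ k → k ≤ N * s ^ 2 → P ((k : ℤ), 0)) ∧
        ∀ k : ℕ, 1 ≤ k → k ≤ N * s ^ 2 → P (0, -(k : ℤ)) := by
  simp only [Urule1, bind_pure_natCast, Finset.forall_mem_union, Finset.forall_mem_image, Finset.mem_Icc, and_imp]

lemma forall_mem_Uijk {i j k : ℕ} {P : Site → Prop} :
    (∀ y ∈ Uijk N s i j k, P y) ↔
      (∀ y : ℕ, 1 ≤ y → y ≤ N * s ^ 2 → P (0, -(y : ℤ))) ∧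
        (∀ w ∈ Wset s, P (w - ((k : ℤ) + (N + j) * s ^ 2, 0))) ∧
          P (((i : ℤ) * s, 2) - ((k : ℤ) + (N + j) * s ^ 2, 0)) := by
  simp only [Uijk, Tset, bind_pure_natCast, Finset.forall_mem_union, Finset.forall_mem_image, Finset.mem_Icc,
    and_imp, Finset.mem_singleton, forall_eq, Nat.cast_mul, Nat.cast_add, Nat.cast_pow]

lemma forall_mem_famS {P : Finset Site → Prop} :
    (∀ U ∈ famS N s S, P U) ↔
      P (Urule0 N s) ∧ P (Urule1 N s) ∧
        ∀ i ∈ Finset.Icc 1 s, ∀ j ∈ Finset.Icc 1 N, j ∈ S i → ∀ k ∈ Finset.Icc 1 (s ^ 2),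
          P (Uijk N s i j k) := by
  simp only [famS, Finset.forall_mem_union, Finset.forall_mem_image, Finset.mem_filter,
    Finset.mem_product, Finset.mem_insert, Finset.mem_singleton, forall_eq_or_imp, forall_eq,
    and_imp, Prod.forall, and_assoc]
  grind

lemma card_Wset (hs : 0 < s) : (Wset s).card = s ^ 2 + s := by
  rw [Wset, bind_pure_natCast, Finset.card_union_of_disjoint, Finset.card_image_of_injective,
    Finset.card_image_of_injective, Finset.card_image_of_injective, Nat.card_Icc, Nat.card_Icc]
  · simp
  · intro l l' h
    simp only [Prod.mk.injEq, Nat.cast_inj, and_true] at h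
    exact Nat.eq_of_mul_eq_mul_right hs h
  · exact Nat.cast_injective
  · intro x x' h
    simpa using h
  · simp only [Finset.disjoint_left, Finset.mem_image]
    rintro _ ⟨x, -, rfl⟩ ⟨l, -, h⟩
    simp at h

end Rules

section StableDirections

variable {N s : ℕ} {S : ℕ → Finset ℕ}

lemma unstable_famS_iff (hN : 0 < N) (hs : 0 < s) (u : ℝ × ℝ) :
    Unstable (famS N s S) u ↔ 0 < u.2 ∧ u.1 ≠ 0 := by
  have hK : 1 ≤ N * s ^ 2 := Nat.mul_pos hN (pow_pos hs 2)
  constructor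
  · contrapose
    intro h
    simp only [Unstable, not_exists, not_and]
    rw [forall_mem_famS]
    simp only [Set.subset_def, Finset.mem_coe, forall_mem_Urule0, forall_mem_Urule1,
      forall_mem_Uijk, halfPlane, inner2, Set.mem_ofPred_eq]
    refine ⟨?_, ?_, ?_⟩
    · rintro ⟨h1, h2⟩
      have h1 := h1 1 le_rfl hK
      have h2 := h2 1 le_rfl hK
      norm_num at h1 h2
      exact h ⟨h2, h1.ne'⟩
    · rintro ⟨h1, h2⟩
      have h1 := h1 1 le_rfl hK
      have h2 := h2 1 le_rfl hK
      norm_num at h1 h2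
      exact h ⟨h2, h1.ne⟩
    · rintro i - j - - k - ⟨h2, h1, -⟩
      have h2 := h2 1 le_rfl hK
      norm_num at h2
      have hu : u.1 = 0 := by
        by_contra hu
        exact h ⟨h2, hu⟩
      have h1 := (forall_mem_Wset.1 h1).1 1 le_rfl (Nat.one_le_pow _ _ hs)
      simp [hu] at h1
  · rintro ⟨h2, h1⟩
    have hpos : ∀ k : ℕ, 1 ≤ k → (0 : ℝ) < k := fun k hk => by exact_mod_cast hk
    rcases h1.lt_or_gt with h1 | h1
    · refine ⟨Urule1 N s, by simp [famS], ?_⟩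
      simp only [Set.subset_def, Finset.mem_coe, forall_mem_Urule1, halfPlane, inner2,
        Set.mem_ofPred_eq]
      constructor
      · intro k hk _
        simpa using mul_neg_of_pos_of_neg (hpos k hk) h1
      · intro k hk _
        simpa using mul_pos (hpos k hk) h2
    · refine ⟨Urule0 N s, by simp [famS], ?_⟩
      simp only [Set.subset_def, Finset.mem_coe, forall_mem_Urule0, halfPlane, inner2,
        Set.mem_ofPred_eq]
      constructor
      · intro k hk _
        simpa using mul_pos (hpos k hk) h1
      · intro k hk _
        simpa using mul_pos (hpos k hk) h2

lemma stable_famS_iff (hN : 0 < N) (hs : 0 < s) (u : ℝ × ℝ) :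
    Stable (famS N s S) u ↔ u ∈ sphere2 ∧ (u.2 ≤ 0 ∨ u = (0, 1)) := by
  rw [Stable, unstable_famS_iff hN hs]
  refine and_congr_right fun hu => ?_
  constructor
  · intro h
    by_cases h2 : u.2 ≤ 0
    · exact Or.inl h2
    · have h1 : u.1 = 0 := by
        by_contra h1
        exact h ⟨not_le.1 h2, h1⟩
      simp only [sphere2, Set.mem_ofPred_eq, h1] at hu
      exact Or.inr (Prod.ext h1 (by simp only; nlinarith))
  · rintro (h | rfl) ⟨h2, h1⟩
    · exact h2.not_ge h
    · exact h1 rfl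

lemma not_isolatedStable_famS (hN : 0 < N) (hs : 0 < s) {u : ℝ × ℝ} (hu : u ∈ sphere2)
    (h2 : u.2 ≤ 0) : ¬ IsolatedStable (famS N s S) u := by
  rintro ⟨-, h⟩
  apply h
  obtain ⟨σ, hσ, hσu⟩ : ∃ σ : ℝ, σ ^ 2 = 1 ∧ 0 ≤ σ * u.1 := by
    rcases le_total 0 u.1 with h1 | h1
    · exact ⟨1, by norm_num, by simpa using h1⟩
    · exact ⟨-1, by norm_num, by simpa using h1⟩
  let w : ℝ → ℝ × ℝ := fun t =>
    (u.1 * Real.cos t + σ * u.2 * Real.sin t, u.2 * Real.cos t - σ * u.1 * Real.sin t)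
  have hw : Continuous w := by fun_prop
  have hw0 : w 0 = u := by simp [w]
  have hlim : Filter.Tendsto w (nhdsWithin 0 (Set.Ioi 0)) (nhds u) := by
    rw [← hw0]
    exact hw.continuousWithinAt
  refine mem_closure_of_tendsto hlim ?_
  filter_upwards [Ioo_mem_nhdsGT (show (0 : ℝ) < Real.pi / 2 by positivity)] with t ht
  have hsin : 0 < Real.sin t :=
    Real.sin_pos_of_pos_of_lt_pi ht.1 (by linarith [ht.2, Real.pi_pos])
  have hcos : 0 < Real.cos t := Real.cos_pos_of_mem_Ioo ⟨by linarith [ht.1, Real.pi_pos], ht.2⟩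
  have hsc := Real.sin_sq_add_cos_sq t
  simp only [sphere2, Set.mem_ofPred_eq] at hu
  refine ⟨(stable_famS_iff hN hs _).2 ⟨?_, Or.inl ?_⟩, ?_⟩
  · simp only [sphere2, Set.mem_ofPred_eq, w]
    linear_combination (Real.sin t ^ 2 * (u.1 ^ 2 + u.2 ^ 2)) * hσ
      + (u.1 ^ 2 + u.2 ^ 2) * hsc + hu
  · simp only [w]
    nlinarith [mul_nonneg hσu hsin.le, mul_nonneg (neg_nonneg.2 h2) hcos.le]
  · intro heq
    have e1 : u.1 * Real.cos t + σ * u.2 * Real.sin t = u.1 := congrArg Prod.fst heq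
    have e2 : u.2 * Real.cos t - σ * u.1 * Real.sin t = u.2 := congrArg Prod.snd heq
    have : Real.cos t = 1 := by
      linear_combination u.1 * e1 + u.2 * e2 + (1 - Real.cos t) * hu
    nlinarith

lemma isolatedStable_famS_up (hN : 0 < N) (hs : 0 < s) :
    IsolatedStable (famS N s S) (0, 1) := by
  refine ⟨(stable_famS_iff hN hs _).2 ⟨by simp [sphere2], Or.inr rfl⟩, fun h => ?_⟩
  have hcl : IsClosed {u : ℝ × ℝ | u.2 ≤ 0} := isClosed_le continuous_snd continuous_const
  have hsub : stableSet (famS N s S) \ {(0, 1)} ⊆ {u : ℝ × ℝ | u.2 ≤ 0} := fun u hu =>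
    ((stable_famS_iff hN hs u).1 hu.1).2.resolve_right hu.2
  have := closure_minimal hsub hcl h
  norm_num at this

lemma critical_famS (hN : 0 < N) (hs : 0 < s) : Critical (famS N s S) := by
  constructor
  · rintro ⟨v, hv, h⟩
    rcases le_or_gt v.2 0 with h2 | h2
    · have hvv : v ∈ openSemicircle v := by
        refine ⟨hv, ?_⟩
        simp only [sphere2, Set.mem_ofPred_eq] at hv
        nlinarith
      exact ((stable_famS_iff hN hs v).2 ⟨hv, Or.inl h2⟩).2 (h v hvv)
    · exact (isolatedStable_famS_up hN hs).1.2 (h (0, 1) ⟨by simp [sphere2], by simpa using h2⟩)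
  · refine ⟨(0, 1), by simp [sphere2], (Set.finite_singleton ((0, 1) : ℝ × ℝ)).subset ?_⟩
    rintro u ⟨hu, -, h2⟩
    simp only [mul_zero, mul_one, zero_add] at h2
    exact ((stable_famS_iff hN hs u).1 hu).2.resolve_left h2.not_ge

lemma difficulty_famS (hN : 0 < N) (hs : 0 < s) :
    difficulty (famS N s S) = dirDifficulty (famS N s S) (0, 1) := by
  refine le_antisymm ?_ ?_
  · refine iInf₂_le_of_le (0, 1) (by simp [sphere2]) (iSup₂_le fun u hu => ?_)
    by_cases h : Unstable (famS N s S) u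
    · simp [dirDifficulty, h]
    · have h2 := hu.2
      simp only [mul_zero, mul_one, zero_add] at h2
      rw [((stable_famS_iff hN hs u).1 ⟨hu.1, h⟩).2.resolve_left h2.not_ge]
  · refine le_iInf₂ fun v hv => ?_
    rcases le_or_gt v.2 0 with h2 | h2
    · have hvv : v ∈ openSemicircle v := by
        refine ⟨hv, ?_⟩
        simp only [sphere2, Set.mem_ofPred_eq] at hv
        nlinarith
      refine le_trans ?_ (le_iSup₂ v hvv)
      rw [dirDifficulty.eq_def _ v,
        if_neg ((stable_famS_iff hN hs v).2 ⟨hv, Or.inl h2⟩).2,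
        if_neg (not_isolatedStable_famS hN hs hv h2)]
      exact le_top
    · exact le_iSup₂ (f := fun u (_ : u ∈ openSemicircle v) => dirDifficulty (famS N s S) u)
        (0, 1) ⟨by simp [sphere2], by simpa using h2⟩

lemma halfPlane_up : halfPlane (0, 1) = {x : Site | x.2 < 0} := by
  ext x
  simp [halfPlane, inner2]

end StableDirections

section Growth

variable {N s : ℕ} {S : ℕ → Finset ℕ}

/-- The set `W` together with the sites `(i·s, 2)` for `i ∈ M`. -/
noncomputable def coverSeed (s : ℕ) (M : Finset ℕ) : Finset Site :=
  Wset s ∪ M.image fun i : ℕ => ((i : ℤ) * s, (2 : ℤ))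

lemma coverSeed_nonneg {M : Finset ℕ} : ∀ z ∈ coverSeed s M, 0 ≤ z.2 := by
  simp only [coverSeed, Finset.forall_mem_union, forall_mem_Wset, Finset.forall_mem_image]
  simp

lemma card_coverSeed_le (hs : 0 < s) (M : Finset ℕ) :
    (coverSeed s M).card ≤ s ^ 2 + s + M.card := by
  rw [← card_Wset hs]
  exact (Finset.card_union_le _ _).trans (Nat.add_le_add_left Finset.card_image_le _)

lemma infinite_bpClosure_coverSeed (hs : 0 < s) {M : Finset ℕ}
    (hM : IsCover N s S M) :
    (bpClosure (famS N s S) ({x : Site | x.2 < 0} ∪ (coverSeed s M : Set Site)) \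
      {x : Site | x.2 < 0}).Infinite := by
  set C := bpClosure (famS N s S) ({x : Site | x.2 < 0} ∪ (coverSeed s M : Set Site)) with hC
  have hsub : {x : Site | x.2 < 0} ∪ (coverSeed s M : Set Site) ⊆ C := subset_bpClosure _
  have hlow : ∀ x : Site, x.2 < 0 → x ∈ C := fun x hx => hsub (Or.inl hx)
  have hn : 0 < s ^ 2 := pow_pos hs 2
  have hpos : ∀ t : ℕ, ((((N + 1) * s ^ 2 + 1 + t : ℕ) : ℤ), (0 : ℤ)) ∈ C := by
    intro t
    induction t using Nat.strong_induction_on with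
    | _ t ih =>
      rcases lt_or_ge t (N * s ^ 2) with ht | ht
      · have hj : t / s ^ 2 + 1 ∈ M.biUnion S := by
          rw [hM.2, Finset.mem_Icc]
          exact ⟨Nat.le_add_left 1 _, (Nat.div_lt_iff_lt_mul hn).2 ht⟩
        obtain ⟨i, hiM, hij⟩ := Finset.mem_biUnion.1 hj
        have hk : t % s ^ 2 + 1 ∈ Finset.Icc 1 (s ^ 2) :=
          Finset.mem_Icc.2 ⟨Nat.le_add_left 1 _, Nat.mod_lt t hn⟩
        have hU := (forall_mem_famS (P := (· ∈ famS N s S))).1 (fun _ h => h)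
        refine mem_bpClosure_of_rule
          (hU.2.2 i (hM.1 hiM) _ (hM.2 ▸ hj) hij _ hk) ?_
        have hx : (((N + 1) * s ^ 2 + 1 + t : ℕ) : ℤ) =
            ((t % s ^ 2 + 1 : ℕ) : ℤ) + ((N : ℤ) + ((t / s ^ 2 + 1 : ℕ) : ℤ)) * (s : ℤ) ^ 2 := by
          have h := Nat.mod_add_div t (s ^ 2)
          zify at h
          push_cast
          linear_combination -h
        rw [forall_mem_Uijk, hx]
        refine ⟨fun y hy _ => hlow _ (by simp; omega), fun w hw => ?_, ?_⟩
        · refine hsub (Or.inr ?_)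
          simpa [coverSeed] using Or.inl hw
        · refine hsub (Or.inr ?_)
          simpa [coverSeed] using Or.inr ⟨i, hiM, Or.inl rfl⟩
      · refine mem_bpClosure_of_rule (U := Urule0 N s) (by simp [famS]) ?_
        rw [forall_mem_Urule0]
        refine ⟨fun k hk hk' => ?_, fun y hy _ => hlow _ (by simp; omega)⟩
        convert ih (t - k) (by omega) using 1
        refine Prod.ext ?_ rfl
        simp only [Prod.mk_add_mk]
        push_cast [Nat.cast_sub (hk'.trans ht)]
        ring
  refine (Set.infinite_range_of_injective (f := fun t : ℕ =>
    ((((N + 1) * s ^ 2 + 1 + t : ℕ) : ℤ), (0 : ℤ))) ?_).mono ?_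
  · intro t t' h
    simpa using h
  · rintro _ ⟨t, rfl⟩
    exact ⟨hpos t, by simp⟩

end Growth

section Obstruction

variable {N s : ℕ} {S : ℕ → Finset ℕ}

lemma le_card_of_row_mem {F : Finset Site} {c : ℕ} {p r : ℤ}
    (h : ∀ k : ℤ, 1 ≤ k → k ≤ c → (p + k, r) ∈ F) : c ≤ F.card := by
  have hinj : Function.Injective fun k : ℤ => ((p + k, r) : Site) := fun k k' hk => by
    simpa using hk
  calc c = ((Finset.Icc (1 : ℤ) c).image fun k => ((p + k, r) : Site)).card := by
        rw [Finset.card_image_of_injective _ hinj]; simp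
    _ ≤ F.card := by
        refine Finset.card_le_card ?_
        simp only [Finset.image_subset_iff, Finset.mem_Icc]
        exact fun k hk => h k hk.1 hk.2

/-- A set containing the lower half-plane is closed under the dynamics as soon as it contains no
long horizontal segment above it and is closed under the rules built on translates of `W`. -/
lemma closed_famS {B : Set Site} (hlow : {x : Site | x.2 < 0} ⊆ B)
    (hrow : ∀ p r : ℤ, 0 ≤ r → ∃ k : ℤ, 1 ≤ k ∧ k ≤ (N * s ^ 2 : ℕ) ∧ (p + k, r) ∉ B)
    (hW : ∀ b : Site, 0 ≤ b.2 → (∀ w ∈ Wset s, b + w ∈ B) → ∀ i ∈ Finset.Icc 1 s,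
      ∀ j ∈ S i, ∀ k ∈ Finset.Icc 1 (s ^ 2), b + ((i : ℤ) * s, 2) ∈ B →
        b + ((k : ℤ) + (N + j) * s ^ 2, 0) ∈ B) :
    ∀ x, ∀ U ∈ famS N s S, (∀ y ∈ U, x + y ∈ B) → x ∈ B := by
  intro x
  rcases lt_or_ge x.2 0 with hx | hx
  · exact fun _ _ _ => hlow hx
  rw [forall_mem_famS]
  refine ⟨fun h => ?_, fun h => ?_, fun i hi j _ hj k hk h => ?_⟩
  · obtain ⟨k, hk1, hk2, hk⟩ := hrow (x.1 - (N * s ^ 2 : ℕ) - 1) x.2 hx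
    have := (forall_mem_Urule0.1 h).1 (((N * s ^ 2 : ℕ) : ℤ) + 1 - k).toNat (by omega) (by omega)
    refine absurd ?_ hk
    convert this using 1
    refine Prod.ext ?_ (by simp)
    simp only [Prod.fst_add]
    omega
  · obtain ⟨k, hk1, hk2, hk⟩ := hrow x.1 x.2 hx
    have := (forall_mem_Urule1.1 h).1 k.toNat (by omega) (by omega)
    refine absurd ?_ hk
    convert this using 1
    refine Prod.ext ?_ (by simp)
    simp only [Prod.fst_add]
    omega
  · obtain ⟨-, h1, h2⟩ := forall_mem_Uijk.1 h
    have := hW (x - ((k : ℤ) + (N + j) * s ^ 2, 0)) (by simpa using hx)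
      (fun w hw => by convert h1 w hw using 1; abel) i hi j hj k hk
      (by convert h2 using 1; abel)
    simpa using this

/-- The sites infected in the row of `a` by the translate `a + W` when the elements of `J` are
covered. -/
def blockSites (N s : ℕ) (J : Finset ℕ) (a : Site) : Set Site :=
  {x | ∃ j ∈ J, ∃ k ∈ Finset.Icc 1 (s ^ 2), x = a + ((k : ℤ) + (N + j) * s ^ 2, 0)}

lemma finite_blockSites (J : Finset ℕ) (a : Site) : (blockSites N s J a).Finite := by
  refine ((J ×ˢ Finset.Icc 1 (s ^ 2)).image fun t : ℕ × ℕ =>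
    a + ((t.2 : ℤ) + (N + t.1) * s ^ 2, 0)).finite_toSet.subset ?_
  rintro x ⟨j, hj, k, hk, rfl⟩
  simp only [Finset.coe_image, Set.mem_image, Finset.mem_coe, Finset.mem_product]
  exact ⟨(j, k), ⟨hj, hk⟩, rfl⟩

lemma mem_blockSites_row {J : Finset ℕ} {a x : Site} (h : x ∈ blockSites N s J a) :
    x.2 = a.2 := by
  obtain ⟨j, -, k, -, rfl⟩ := h
  simp

/-- A small seed without any translate of `W` infects only finitely many sites. -/
lemma finite_bpClosure_of_no_translate {Z : Finset Site} (hcard : Z.card < N * s ^ 2)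
    (hW : ∀ a : Site, ¬ ∀ w ∈ Wset s, a + w ∈ Z) :
    (bpClosure (famS N s S) ({x : Site | x.2 < 0} ∪ (Z : Set Site)) \
      {x : Site | x.2 < 0}).Finite := by
  refine Z.finite_toSet.subset ?_
  rw [Set.sdiff_subset_iff]
  refine bpClosure_subset le_rfl (closed_famS Set.subset_union_left ?_ ?_)
  · intro p r hr
    by_contra! h
    refine hcard.not_ge (le_card_of_row_mem (p := p) (r := r) fun k hk1 hk2 => ?_)
    exact (h k hk1 hk2).resolve_left (by simpa using hr)
  · intro b hb h
    refine absurd (fun w hw => (h w hw).resolve_left ?_) (hW b)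
    have : ∀ w ∈ Wset s, 0 ≤ w.2 := by rw [forall_mem_Wset]; simp
    simpa using add_nonneg hb (this w hw)

/-- If `J` misses an element of `{1,…,N}`, every horizontal segment of length `N·s²` in the row of
`a` contains `s` consecutive sites outside `a + W` and the blocks of `J`. -/
lemma exists_segment_outside_blocks (hN : 4 ≤ N) (hs : 4 ≤ s) {J : Finset ℕ} {j₀ : ℕ}
    (hj₀ : j₀ ∈ Finset.Icc 1 N) (hJ : j₀ ∉ J) (hJN : J ⊆ Finset.Icc 1 N) (a : Site) (p : ℤ) :
    ∃ q : ℤ, ∀ k : ℤ, 1 ≤ k → k ≤ s →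
      (p + 1 ≤ q + k ∧ q + k ≤ p + (N * s ^ 2 : ℕ)) ∧
      (q + k ≤ a.1 ∨ a.1 + s ^ 2 < q + k) ∧ (q + k, a.2) ∉ blockSites N s J a := by
  have hn : 4 * (s : ℤ) ≤ (s : ℤ) ^ 2 := by
    have : (4 : ℤ) ≤ s := by exact_mod_cast hs
    nlinarith
  have hNn : 4 * (s : ℤ) ^ 2 ≤ N * (s : ℤ) ^ 2 :=
    mul_le_mul_of_nonneg_right (by exact_mod_cast hN) (by positivity)
  rw [Finset.mem_Icc] at hj₀
  have hj1 : (s : ℤ) ^ 2 ≤ j₀ * (s : ℤ) ^ 2 :=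
    le_mul_of_one_le_left (by positivity) (by exact_mod_cast hj₀.1)
  have hj2 : (j₀ : ℤ) * (s : ℤ) ^ 2 ≤ N * (s : ℤ) ^ 2 :=
    mul_le_mul_of_nonneg_right (by exact_mod_cast hj₀.2) (by positivity)
  have hblock : ∀ x : ℤ, (x, a.2) ∈ blockSites N s J a →
      a.1 + N * (s : ℤ) ^ 2 + (s : ℤ) ^ 2 < x ∧
        x ≤ a.1 + 2 * (N * (s : ℤ) ^ 2) + (s : ℤ) ^ 2 ∧
        (x ≤ a.1 + N * (s : ℤ) ^ 2 + j₀ * (s : ℤ) ^ 2 ∨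
          a.1 + N * (s : ℤ) ^ 2 + j₀ * (s : ℤ) ^ 2 + (s : ℤ) ^ 2 < x) := by
    rintro x ⟨j, hj, k, hk, hx⟩
    have hx1 : x = a.1 + (k + (N + j) * (s : ℤ) ^ 2) := congrArg Prod.fst hx
    have hjN := Finset.mem_Icc.1 (hJN hj)
    rw [Finset.mem_Icc] at hk
    have hk1 : (1 : ℤ) ≤ k := by exact_mod_cast hk.1
    have hk2 : (k : ℤ) ≤ (s : ℤ) ^ 2 := by exact_mod_cast hk.2
    have h1 : (s : ℤ) ^ 2 ≤ j * (s : ℤ) ^ 2 :=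
      le_mul_of_one_le_left (by positivity) (by exact_mod_cast hjN.1)
    have h2 : (j : ℤ) * (s : ℤ) ^ 2 ≤ N * (s : ℤ) ^ 2 :=
      mul_le_mul_of_nonneg_right (by exact_mod_cast hjN.2) (by positivity)
    refine ⟨by linarith, by linarith, ?_⟩
    rcases lt_or_gt_of_ne (show j ≠ j₀ from fun h => hJ (h ▸ hj)) with h | h
    · have : ((j : ℤ) + 1) * (s : ℤ) ^ 2 ≤ j₀ * (s : ℤ) ^ 2 :=
        mul_le_mul_of_nonneg_right (by exact_mod_cast h) (by positivity)
      left; linarith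
    · have : ((j₀ : ℤ) + 1) * (s : ℤ) ^ 2 ≤ j * (s : ℤ) ^ 2 :=
        mul_le_mul_of_nonneg_right (by exact_mod_cast h) (by positivity)
      right; linarith
  push_cast
  suffices h : ∃ q : ℤ, p ≤ q ∧ q + s ≤ p + N * (s : ℤ) ^ 2 ∧
      (q + s ≤ a.1 ∨ (a.1 + (s : ℤ) ^ 2 ≤ q ∧
        (q + s ≤ a.1 + N * (s : ℤ) ^ 2 + (s : ℤ) ^ 2 ∨
          (a.1 + N * (s : ℤ) ^ 2 + j₀ * (s : ℤ) ^ 2 ≤ q ∧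
            q + s ≤ a.1 + N * (s : ℤ) ^ 2 + j₀ * (s : ℤ) ^ 2 + (s : ℤ) ^ 2) ∨
          a.1 + 2 * (N * (s : ℤ) ^ 2) + (s : ℤ) ^ 2 ≤ q))) by
    obtain ⟨q, h1, h2, h3⟩ := h
    refine ⟨q, fun k hk1 hk2 => ⟨⟨by omega, by omega⟩, by omega, fun hb => ?_⟩⟩
    have := hblock _ hb
    omega
  generalize (N : ℤ) * (s : ℤ) ^ 2 = K at *
  generalize (j₀ : ℤ) * (s : ℤ) ^ 2 = c at *
  generalize (s : ℤ) ^ 2 = n at *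
  have hr : (0 : ℤ) ≤ s := by positivity
  generalize (s : ℤ) = r at *
  generalize a.1 = α at *
  by_cases c1 : p + r ≤ α
  · exact ⟨p, by omega⟩
  by_cases c2 : p + r ≤ α + K + n
  · exact ⟨max p (α + n), by omega⟩
  by_cases c3 : p + r ≤ α + K + c + n
  · exact ⟨max p (α + K + c), by omega⟩
  · exact ⟨p + K - r, by omega⟩

/-- A seed with a translate of `W` and too few further sites for a cover infects only finitely many
sites. -/
lemma finite_bpClosure_of_translate (hN : 4 ≤ N) (hs : 4 ≤ s)
    (hS : ∀ i ∈ Finset.Icc 1 s, S i ⊆ Finset.Icc 1 N) {m : ℕ} (hms : m ≤ s)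
    (hmin : ∀ M : Finset ℕ, IsCover N s S M → m ≤ M.card) {Z : Finset Site}
    (hcard : Z.card < s ^ 2 + s + m) {a : Site} (ha : ∀ w ∈ Wset s, a + w ∈ Z) :
    (bpClosure (famS N s S) ({x : Site | x.2 < 0} ∪ (Z : Set Site)) \
      {x : Site | x.2 < 0}).Finite := by
  have hn : 4 * s ≤ s ^ 2 := by nlinarith
  have hK : s ^ 2 < N * s ^ 2 := by nlinarith
  set V : Finset Site := (Wset s).image (a + ·) with hV
  set F : Finset Site := Z \ V with hF
  have hVZ : V ⊆ Z := Finset.image_subset_iff.2 ha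
  have hFm : F.card < m := by
    have h : F.card + V.card = Z.card := Finset.card_sdiff_add_card_eq_card hVZ
    have hVcard : V.card = s ^ 2 + s := by
      rw [hV, Finset.card_image_of_injective _ (add_right_injective a), card_Wset (by omega)]
    omega
  have hVmem : ∀ x ∈ V, (x.2 = a.2 ∧ a.1 < x.1 ∧ x.1 ≤ a.1 + (s : ℤ) ^ 2) ∨
      x.2 = a.2 + 1 ∧ ∃ l : ℕ, 1 ≤ l ∧ l ≤ s ∧ x.1 = a.1 + l * s := by
    rw [hV, Finset.forall_mem_image, forall_mem_Wset]
    refine ⟨fun x h1 h2 => Or.inl ⟨by simp, by simp; omega, ?_⟩,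
      fun l h1 h2 => Or.inr ⟨by simp, l, h1, h2, by simp⟩⟩
    have : (x : ℤ) ≤ (s : ℤ) ^ 2 := by exact_mod_cast h2
    simpa using this
  set I : Finset ℕ := {i ∈ Finset.Icc 1 s | a + ((i : ℤ) * s, 2) ∈ Z} with hI
  have hIF : I.card ≤ F.card := by
    refine Finset.card_le_card_of_injOn (fun i : ℕ => a + ((i : ℤ) * s, 2)) ?_ ?_
    · intro i hi
      have hi := (Finset.mem_filter.1 hi).2
      refine Finset.mem_sdiff.2 ⟨hi, fun h => ?_⟩
      have := hVmem _ h
      simp at this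
    · intro i _ i' _ h
      simp only [add_right_inj, Prod.mk.injEq, and_true] at h
      exact_mod_cast mul_right_cancel₀ (by positivity) h
  set J : Finset ℕ := I.biUnion S with hJ
  have hJN : J ⊆ Finset.Icc 1 N :=
    Finset.biUnion_subset.2 fun i hi => hS i (Finset.mem_filter.1 hi).1
  obtain ⟨j₀, hj₀, hj₀J⟩ : ∃ j₀ ∈ Finset.Icc 1 N, j₀ ∉ J := by
    by_contra! h
    have := hmin I ⟨Finset.filter_subset _ _, hJN.antisymm h⟩
    omega
  set B : Set Site := {x : Site | x.2 < 0} ∪ ((Z : Set Site) ∪ blockSites N s J a) with hB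
  refine (Z.finite_toSet.union (finite_blockSites (N := N) (s := s) J a)).subset ?_
  rw [Set.sdiff_subset_iff]
  have hBZ : ∀ x ∈ B, 0 ≤ x.2 → x ∉ blockSites N s J a → x ∈ Z := by
    rintro x (hx | hx | hx) h0 hb
    · exact absurd h0 (not_le.2 hx)
    · exact hx
    · exact absurd hx hb
  -- `F` contains no `s` consecutive sites of a row
  have hFrow : ∀ q r : ℤ, ¬ ∀ k : ℤ, 1 ≤ k → k ≤ s → (q + k, r) ∈ F := fun q r h => by
    have := le_card_of_row_mem h
    omega
  have hoff : ∀ p r : ℤ, 0 ≤ r → r ≠ a.2 →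
      ¬ ∀ k : ℤ, 1 ≤ k → k ≤ (s ^ 2 : ℕ) → (p + k, r) ∈ B := by
    intro p r hr hra h
    have hsub : ∀ k : ℤ, 1 ≤ k → k ≤ (s ^ 2 : ℕ) → (p + k, r) ∈
        F ∪ (Finset.Icc 1 s).image fun l : ℕ => ((a.1 + l * s, a.2 + 1) : Site) := by
      intro k hk1 hk2
      have hZ := hBZ _ (h k hk1 hk2) hr fun hb => hra (mem_blockSites_row hb)
      rw [Finset.mem_union, Finset.mem_image]
      by_cases hkV : (p + k, r) ∈ V
      · rcases hVmem _ hkV with ⟨h, -⟩ | ⟨h, l, hl1, hl2, hl⟩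
        · exact absurd h hra
        · exact Or.inr ⟨l, Finset.mem_Icc.2 ⟨hl1, hl2⟩, Prod.ext hl.symm h.symm⟩
      · exact Or.inl (Finset.mem_sdiff.2 ⟨hZ, hkV⟩)
    have h1 := (le_card_of_row_mem hsub).trans (Finset.card_union_le _ _)
    have h2 : ((Finset.Icc 1 s).image fun l : ℕ => ((a.1 + l * s, a.2 + 1) : Site)).card ≤ s :=
      Finset.card_image_le.trans (by simp)
    omega
  refine bpClosure_subset (Set.union_subset_union_right _ Set.subset_union_left)
    (closed_famS Set.subset_union_left ?_ ?_)
  · intro p r hr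
    by_contra! h
    by_cases hra : r = a.2
    · subst hra
      obtain ⟨q, hq⟩ := exists_segment_outside_blocks hN hs hj₀ hj₀J hJN a p
      refine hFrow q a.2 fun k hk1 hk2 => ?_
      obtain ⟨⟨hp1, hp2⟩, hW, hb⟩ := hq k hk1 hk2
      have hmem := h (q + k - p) (by omega) (by omega)
      rw [add_sub_cancel] at hmem
      refine Finset.mem_sdiff.2 ⟨hBZ _ hmem hr hb, fun hV => ?_⟩
      rcases hVmem _ hV with ⟨-, h1, h2⟩ | ⟨h1, -⟩
      · simp only at h1 h2
        omega
      · simp at h1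
    · exact hoff p r hr hra fun k hk1 hk2 => h k hk1 (by omega)
  · intro b hb hbW i hi j hj k hk hbi
    rw [forall_mem_Wset] at hbW
    have hbrow : ∀ k : ℤ, 1 ≤ k → k ≤ (s ^ 2 : ℕ) → (b.1 + k, b.2) ∈ B := by
      intro k hk1 hk2
      have := hbW.1 k.toNat (by omega) (by omega)
      rw [Int.toNat_of_nonneg (by omega)] at this
      convert this using 1
      exact Prod.ext rfl (by simp)
    have hba : b.2 = a.2 := by
      by_contra hba
      exact hoff b.1 b.2 hb hba hbrow
    obtain ⟨l, l', hl1, hl2, hl1', hl2', hll⟩ : ∃ l l' : ℕ, 1 ≤ l ∧ l ≤ s ∧ 1 ≤ l' ∧ l' ≤ s ∧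
        b.1 + l * s = a.1 + l' * s := by
      by_contra! hne
      have hsub : ∀ l ∈ Finset.Icc 1 s, b + ((l : ℤ) * s, 1) ∈ F := by
        intro l hl
        rw [Finset.mem_Icc] at hl
        refine Finset.mem_sdiff.2 ⟨hBZ _ (hbW.2 l hl.1 hl.2) ?_ fun h => ?_, fun h => ?_⟩
        · simp; omega
        · have := mem_blockSites_row h
          simp [hba] at this
        · rcases hVmem _ h with ⟨h1, -⟩ | ⟨-, l', h1, h2, h3⟩
          · simp [hba] at h1
          · exact hne l l' hl.1 hl.2 h1 h2 h3
      have hinj : Set.InjOn (fun l : ℕ => b + ((l : ℤ) * s, 1)) (Finset.Icc 1 s) := by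
        intro l _ l' _ h
        simp only [add_right_inj, Prod.mk.injEq, and_true] at h
        exact_mod_cast mul_right_cancel₀ (by positivity) h
      have := Finset.card_le_card_of_injOn _ hsub hinj
      simp at this
      omega
    -- a shifted translate would need `s` consecutive sites next to `a + W`
    have hshift : ∀ q : ℤ, b.1 ≤ q → q + s ≤ b.1 + (s : ℤ) ^ 2 →
        q + s ≤ a.1 + 2 * (s : ℤ) ^ 2 → ¬ (q + s ≤ a.1 ∨ a.1 + (s : ℤ) ^ 2 ≤ q) := by
      intro q h1 h2 h3 h4
      refine hFrow q b.2 fun k hk1 hk2 => ?_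
      have hmem := hbrow (q + k - b.1) (by omega) (by push_cast; omega)
      rw [add_sub_cancel] at hmem
      refine Finset.mem_sdiff.2 ⟨hBZ _ hmem hb ?_, fun hV => ?_⟩
      · rintro ⟨j, -, k', hk', hx⟩
        have hx1 : q + k = a.1 + (k' + (N + j) * (s : ℤ) ^ 2) := congrArg Prod.fst hx
        have : (4 : ℤ) * (s : ℤ) ^ 2 ≤ (N + j) * (s : ℤ) ^ 2 :=
          mul_le_mul_of_nonneg_right (by exact_mod_cast hN.trans (Nat.le_add_right N j))
            (by positivity)
        have := (Finset.mem_Icc.1 hk').1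
        omega
      · rcases hVmem _ hV with ⟨-, h5, h6⟩ | ⟨h5, -⟩
        · simp only at h5 h6
          omega
        · simp [hba] at h5
    have hn' : 4 * (s : ℤ) ≤ (s : ℤ) ^ 2 := by exact_mod_cast hn
    have hab : b.1 = a.1 := by
      rcases lt_trichotomy l l' with hlt | heq | hlt
      · have e1 : ((l : ℤ) + 1) * s ≤ l' * s :=
          mul_le_mul_of_nonneg_right (by exact_mod_cast hlt) (by positivity)
        have e2 : (l' : ℤ) * s ≤ s * s :=
          mul_le_mul_of_nonneg_right (by exact_mod_cast hl2') (by positivity)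
        have e3 : (1 : ℤ) * s ≤ l * s :=
          mul_le_mul_of_nonneg_right (by exact_mod_cast hl1) (by positivity)
        rw [← sq] at e2
        exact absurd (Or.inr le_rfl) (hshift (a.1 + (s : ℤ) ^ 2) (by linarith) (by linarith)
          (by linarith))
      · subst heq
        linarith
      · have e1 : ((l' : ℤ) + 1) * s ≤ l * s :=
          mul_le_mul_of_nonneg_right (by exact_mod_cast hlt) (by positivity)
        have e2 : (l : ℤ) * s ≤ s * s :=
          mul_le_mul_of_nonneg_right (by exact_mod_cast hl2) (by positivity)
        have e3 : (1 : ℤ) * s ≤ l' * s :=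
          mul_le_mul_of_nonneg_right (by exact_mod_cast hl1') (by positivity)
        rw [← sq] at e2
        exact absurd (Or.inl (by linarith)) (hshift (a.1 - s) (by linarith) (by linarith)
          (by linarith))
    obtain rfl : b = a := Prod.ext hab hba
    have hiI : i ∈ I := by
      refine Finset.mem_filter.2 ⟨hi, hBZ _ hbi ?_ fun h => ?_⟩
      · simp; omega
      · have := mem_blockSites_row h
        simp at this
    exact Or.inr (Or.inr ⟨j, Finset.mem_biUnion.2 ⟨i, hiI, hj⟩, k, hk, rfl⟩)

end Obstruction

/-- `𝒰_S` is critical and `α(𝒰_S) = s² + s + m` where `m` is the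
minimum cardinality of a cover. -/
theorem famS_critical_and_difficulty (N s : ℕ) (hN : 4 ≤ N) (hs : 4 ≤ s)
    (S : ℕ → Finset ℕ) (hS : ∀ i ∈ Finset.Icc 1 s, S i ⊆ Finset.Icc 1 N)
    (hcov : (Finset.Icc 1 s).biUnion S = Finset.Icc 1 N)
    (m : ℕ) (hm : ∃ M : Finset ℕ, IsCover N s S M ∧ M.card = m)
    (hmin : ∀ M : Finset ℕ, IsCover N s S M → m ≤ M.card) :
    Critical (famS N s S) ∧ difficulty (famS N s S) = ((s ^ 2 + s + m : ℕ) : ℕ∞) := by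
  have hN0 : 0 < N := by omega
  have hs0 : 0 < s := by omega
  refine ⟨critical_famS hN0 hs0, ?_⟩
  rw [difficulty_famS hN0 hs0, dirDifficulty, if_neg (isolatedStable_famS_up hN0 hs0).1.2,
    if_pos (isolatedStable_famS_up hN0 hs0), halfPlane_up]
  have hlower : ∀ Z : Finset Site,
      (bpClosure (famS N s S) ({x : Site | x.2 < 0} ∪ (Z : Set Site)) \
        {x : Site | x.2 < 0}).Infinite → s ^ 2 + s + m ≤ Z.card := by
    intro Z hinf
    by_contra! hcard
    have hms : m ≤ s := by simpa using hmin _ ⟨subset_rfl, hcov⟩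
    refine hinf ?_
    by_cases ha : ∃ a : Site, ∀ w ∈ Wset s, a + w ∈ Z
    · obtain ⟨a, ha⟩ := ha
      exact finite_bpClosure_of_translate hN hs hS hms hmin hcard ha
    · refine finite_bpClosure_of_no_translate ?_ (not_exists.1 ha)
      nlinarith
  refine le_antisymm ?_ (le_sInf ?_)
  · obtain ⟨M, hM, rfl⟩ := hm
    have hinf := infinite_bpClosure_coverSeed hs0 hM
    refine sInf_le ⟨coverSeed s M, fun z hz => not_lt.2 (coverSeed_nonneg z hz), hinf, ?_⟩
    exact congrArg _ ((hlower _ hinf).antisymm (card_coverSeed_le hs0 M))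
  · rintro _ ⟨Z, -, hinf, rfl⟩
    exact_mod_cast hlower Z hinf
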